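/- Assume all influences are non-negative, p_t is a price, and Z ∪ W ∪ O is an admissible partition at p_t. Let W₂ ⊆ W, and suppose u ∈ ℝ^n is entrywise non-negative, non-zero, satisfies u_i = 0 for every i ∉ W₂, and L_{W₂×W₂} u_{W₂} = λ u_{W₂} for some real λ ≥ 1. Let k be an index attaining the minimum of (1 − q^t_i)/u_i over all i with u_i ≠ 0. Then for every ε > 0, [q̲(p_t − ε)]_k = 1. -/

import Mathlib

open Filter Topology

/-- med{0,1,x} = max(0, min(1, x)). -/
noncomputable def med (x : ℝ) : ℝ := max 0 (min 1 x)

/-- The transfer function `f_p` of the pricing game. -/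
noncomputable def transfer {ι : Type*} [Fintype ι] (a b : ι → ℝ)
    (T : Matrix ι ι ℝ) (p : ℝ) (q : ι → ℝ) : ι → ℝ :=
  fun i => med ((b i - p + ∑ j, T j i * q j) / (b i - a i))

theorem med_mono : Monotone med := fun _ _ h =>
  max_le_max le_rfl (min_le_min le_rfl h)

theorem continuous_transfer {ι : Type*} [Fintype ι] (a b : ι → ℝ) (T : Matrix ι ι ℝ) (p : ℝ) :
    Continuous (transfer a b T p) := by
  unfold transfer med
  fun_prop

/-- With non-negative influences, lower prices and larger states give larger responses. -/
theorem transfer_le_transfer {ι : Type*} [Fintype ι] {a b : ι → ℝ} {T : Matrix ι ι ℝ}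
    (hab : ∀ i, a i < b i) (hT : ∀ i j, 0 ≤ T j i) {p p' : ℝ} (hp : p' ≤ p) {q q' : ι → ℝ}
    (hq : q ≤ q') : transfer a b T p q ≤ transfer a b T p' q' := by
  intro i
  refine med_mono (div_le_div_of_nonneg_right ?_ (sub_pos.2 (hab i)).le)
  have hsum : ∑ j, T j i * q j ≤ ∑ j, T j i * q' j :=
    Finset.sum_le_sum fun j _ => mul_le_mul_of_nonneg_left (hq j) (hT i j)
  linarith

theorem iterate_transfer_le_iterate_transfer {ι : Type*} [Fintype ι] {a b : ι → ℝ}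
    {T : Matrix ι ι ℝ} (hab : ∀ i, a i < b i) (hT : ∀ i j, 0 ≤ T j i) {p p' : ℝ} (hp : p' ≤ p)
    (q : ι → ℝ) (m : ℕ) : (transfer a b T p)^[m] q ≤ (transfer a b T p')^[m] q := by
  induction m with
  | zero => exact le_rfl
  | succ m ih =>
    rw [Function.iterate_succ_apply', Function.iterate_succ_apply']
    exact transfer_le_transfer hab hT hp ih

/-- existence of a pivot, eigenvector version: with non-negative
influences, given an admissible partition `Z ∪ W ∪ O` at price `p_t`, a subset
`W₂ ⊆ W`, a non-negative non-zero vector `u` supported on `W₂` with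
`L_{W₂×W₂} u_{W₂} = λ u_{W₂}` for some `λ ≥ 1`, and `k` minimizing
`(1 − q^t_i)/u_i` over indices with `u_i ≠ 0`, the pessimistic equilibrium at
any lower price `p_t − ε` has `k`-th coordinate equal to `1`. -/
theorem pivot_of_eigenvector (n : ℕ) (a b : Fin n → ℝ)
    (T : Matrix (Fin n) (Fin n) ℝ)
    (ha : ∀ i, 0 ≤ a i) (hab : ∀ i, a i < b i)
    (hTdiag : ∀ i, T i i = 0) (hTnn : ∀ i j, 0 ≤ T j i)
    (L : Matrix (Fin n) (Fin n) ℝ) (hL : ∀ i j, L i j = T j i / (b i - a i))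
    (pt : ℝ) (qt : Fin n → ℝ)
    -- q^t = q̲(p_t), the pessimistic equilibrium at price p_t
    (hqt : ∀ i, Tendsto (fun m : ℕ => (transfer a b T pt)^[m] (fun _ => 0) i)
      atTop (𝓝 (qt i)))
    (x y : Fin n → ℝ)
    (hx : ∀ i, x i = (b i - pt) / (b i - a i))
    (hy : ∀ i, y i = 1 / (b i - a i))
    -- admissible partition at p_t
    (Z W O : Finset (Fin n))
    (hZW : Disjoint Z W) (hZO : Disjoint Z O) (hWO : Disjoint W O)
    (hunion : Z ∪ W ∪ O = Finset.univ)
    (hZ : ∀ i ∈ Z, qt i = 0 ∧ (x + L.mulVec qt) i < 0)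
    (hW : ∀ i ∈ W, qt i = (x + L.mulVec qt) i ∧ 0 ≤ qt i ∧ qt i < 1)
    (hO : ∀ i ∈ O, qt i = 1 ∧ 1 ≤ (x + L.mulVec qt) i)
    -- eigenvector data
    (W₂ : Finset (Fin n)) (hW₂ : W₂ ⊆ W)
    (u : Fin n → ℝ) (hunn : ∀ i, 0 ≤ u i) (hune : u ≠ 0)
    (husupp : ∀ i, i ∉ W₂ → u i = 0)
    (lam : ℝ) (hlam : 1 ≤ lam)
    (heig : ∀ i ∈ W₂, ∑ j ∈ W₂, L i j * u j = lam * u i)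
    -- the pivot
    (k : Fin n) (hk : u k ≠ 0)
    (hkmin : ∀ i, u i ≠ 0 → (1 - qt k) / u k ≤ (1 - qt i) / u i) :
    ∀ ε > (0:ℝ), ∀ ql : Fin n → ℝ,
      (∀ i, Tendsto (fun m : ℕ => (transfer a b T (pt - ε))^[m] (fun _ => 0) i)
        atTop (𝓝 (ql i))) →
      ql k = 1 := by
  intro ε hε ql hql
  have hfix : transfer a b T (pt - ε) ql = ql :=
    isFixedPt_of_tendsto_iterate (tendsto_pi_nhds.2 hql) (continuous_transfer a b T _).continuousAt
  have hle (i : Fin n) : qt i ≤ ql i := le_of_tendsto_of_tendsto' (hqt i) (hql i) fun m =>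
    iterate_transfer_le_iterate_transfer hab hTnn (sub_le_self pt hε.le) _ m i
  have hLnn (i j : Fin n) : 0 ≤ L i j := by
    rw [hL]
    exact div_nonneg (hTnn i j) (sub_pos.2 (hab i)).le
  have hresp (i : Fin n) :
      ql i = med (x i + ε / (b i - a i) + ∑ j, L i j * ql j) := by
    conv_lhs => rw [← hfix]
    unfold transfer
    congr 1
    simp only [hx, hL, div_mul_eq_mul_div, ← Finset.sum_div, ← add_div]
    ring
  have hql_le (i : Fin n) : ql i ≤ 1 := by
    rw [hresp]
    exact max_le zero_le_one (min_le_left _ _)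
  have hupos {i : Fin n} (hi : u i ≠ 0) : 0 < u i := lt_of_le_of_ne (hunn i) hi.symm
  obtain ⟨i, hi, hmin⟩ := Finset.exists_min_image (Finset.univ.filter fun i => u i ≠ 0)
    (fun i => (ql i - qt i) / u i) ⟨k, by simpa using hk⟩
  simp only [Finset.mem_filter, Finset.mem_univ, true_and] at hi hmin
  set c := (ql i - qt i) / u i
  have hc0 : 0 ≤ c := div_nonneg (sub_nonneg.2 (hle i)) (hunn i)
  have hci : c * u i = ql i - qt i := div_mul_cancel₀ _ hi
  have hd (j : Fin n) : c * u j ≤ ql j - qt j := by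
    by_cases hj : u j = 0
    · simpa [hj] using hle j
    · exact (le_div_iff₀ (hupos hj)).1 (hmin j hj)
  have hiW₂ : i ∈ W₂ := by
    by_contra h
    exact hi (husupp i h)
  have heigen : ∑ j, L i j * u j = lam * u i := by
    rw [← heig i hiW₂]
    refine (Finset.sum_subset (Finset.subset_univ _) fun j _ hj => ?_).symm
    rw [husupp j hj, mul_zero]
  have hgrow : c * (lam * u i) + ∑ j, L i j * qt j ≤ ∑ j, L i j * ql j := by
    rw [← heigen, Finset.mul_sum, ← Finset.sum_add_distrib]
    refine Finset.sum_le_sum fun j _ => ?_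
    linarith [mul_le_mul_of_nonneg_left (hd j) (hLnn i j)]
  -- The coordinate with the least relative increase must be saturated.
  have hsat : 1 ≤ ql i := by
    by_contra! hlt
    have hqi : qt i = x i + ∑ j, L i j * qt j := (hW i (hW₂ hiW₂)).1
    have hpos : 0 < ε / (b i - a i) := div_pos hε (sub_pos.2 (hab i))
    have hge : min 1 (x i + ε / (b i - a i) + ∑ j, L i j * ql j) ≤ ql i := by
      conv_rhs => rw [hresp]
      exact le_max_right _ _
    have hlam_mul : c * u i ≤ c * (lam * u i) :=
      mul_le_mul_of_nonneg_left (le_mul_of_one_le_left (hunn i) hlam) hc0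
    rcases min_le_iff.1 hge with h | h <;> linarith
  have hkc : (1 - qt k) / u k ≤ c :=
    (hkmin i hi).trans (div_le_div_of_nonneg_right (by linarith) (hunn i))
  have hk1 : 1 - qt k ≤ c * u k := (div_le_iff₀ (hupos hk)).1 hkc
  exact le_antisymm (hql_le k) (by linarith [hd k])
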